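/- Let (w,α) ∈ S_{λ,μ} and let i, j with |i−j| > 1 be such that k_i := ⟨w(λ+ρ), α_i^∨⟩ > 0, k_j := ⟨w(λ+ρ), α_j^∨⟩ > 0, e_i^{k_i}(α) ≠ 0 and e_j^{k_j}(α) ≠ 0. Then e_i^{k_i}(e_j^{k_j}(α)) = e_j^{k_j}(e_i^{k_i}(α)) ≠ 0. -/

import Mathlib

open scoped BigOperators

namespace KFC

/-- A (candidate) root is a pair of 1-based indices. -/
abbrev Root : Type := ℕ × ℕ

/-- A Kostant partition is encoded as a multiplicity function on pairs. -/
abbrev KPf : Type := Root → ℕ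

/-- An entry of a signed word: a sign (`true` = '+', `false` = '−') together
with the root lying under it. -/
abbrev Entry : Type := Bool × Root

/-- `p` is a positive root of type `A_{n-1}`. -/
def IsPos (n : ℕ) (p : Root) : Prop := 1 ≤ p.1 ∧ p.1 < p.2 ∧ p.2 ≤ n

/-- `α` is a genuine Kostant partition for type `A_{n-1}`: it is supported on
positive roots. -/
def IsKP (n : ℕ) (α : KPf) : Prop := ∀ p, α p ≠ 0 → IsPos n p

/-- Add one copy of the root `r`. -/
def KPadd (α : KPf) (r : Root) : KPf := fun p => if p = r then α p + 1 else α p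

/-- Remove one copy of the root `r`. -/
def KPsub (α : KPf) (r : Root) : KPf := fun p => if p = r then α p - 1 else α p

/-- Replace one copy of `r` by one copy of `r'`. -/
def KPmove (α : KPf) (r r' : Root) : KPf := KPadd (KPsub α r) r'

/-- The signed word `W_i` of `α`: roots `(a,b)` ordered by decreasing `a` and,
for equal `a`, increasing `b`; a '+' under each `(h,i)` and a '−' under each
`(h,i+1)`. -/
def Wword (n i : ℕ) (α : KPf) : List Entry :=
  ((List.range (n+1)).reverse).flatMap (fun h =>
    List.replicate (α (h, i)) ((true, (h, i)) : Entry) ++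
    List.replicate (α (h, i+1)) ((false, (h, i+1)) : Entry))

/-- The signed word `W_i*` of `α`: roots `(a,b)` ordered by increasing `b` and,
for equal `b`, decreasing `a`; a '+' under each `(i+1,j)` and a '−' under each
`(i,j)`. -/
def Wstar (n i : ℕ) (α : KPf) : List Entry :=
  (List.range (n+1)).flatMap (fun j =>
    List.replicate (α (i+1, j)) ((true, (i+1, j)) : Entry) ++
    List.replicate (α (i, j)) ((false, (i, j)) : Entry))

/-- One step of the left-to-right reduction: a new '+' cancels the rightmost
surviving '−' (the surviving word always has the shape `+^a −^b`). -/
def redStep (s : List Entry) (e : Entry) : List Entry :=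
  match e.1, s.getLast? with
  | true, some (false, _) => s.dropLast
  | _, _ => s ++ [e]

/-- The reduced word (list of surviving entries, in order). -/
def reduceW (w : List Entry) : List Entry := w.foldl redStep []

def plusCt (w : List Entry) : ℕ := (w.filter (fun e => e.1)).length
def minusCt (w : List Entry) : ℕ := (w.filter (fun e => !e.1)).length

/-- `a_i`: number of '+' in the reduced word of `W_i`. -/
def aSt (n i : ℕ) (α : KPf) : ℕ := plusCt (reduceW (Wword n i α))
/-- `b_i`: number of '−' in the reduced word of `W_i`. -/
def bSt (n i : ℕ) (α : KPf) : ℕ := minusCt (reduceW (Wword n i α))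
/-- `a_i*`. -/
def aStar (n i : ℕ) (α : KPf) : ℕ := plusCt (reduceW (Wstar n i α))
/-- `b_i*`. -/
def bStar (n i : ℕ) (α : KPf) : ℕ := minusCt (reduceW (Wstar n i α))
/-- `u_i`: number of '+' in the reduced word of `W_i* W_i`. -/
def uSt (n i : ℕ) (α : KPf) : ℕ := plusCt (reduceW (Wstar n i α ++ Wword n i α))
/-- `v_i`: number of '−' in the reduced word of `W_i* W_i`. -/
def vSt (n i : ℕ) (α : KPf) : ℕ := minusCt (reduceW (Wstar n i α ++ Wword n i α))

/-- The root under the rightmost surviving '+'. -/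
def lastPlus (w : List Entry) : Option Root :=
  (((reduceW w).filter (fun e => e.1)).getLast?).map Prod.snd

/-- The root under the leftmost surviving '−'. -/
def headMinus (w : List Entry) : Option Root :=
  (((reduceW w).filter (fun e => !e.1)).head?).map Prod.snd

/-- The operator `f̃_i`. -/
def ftilde (n i : ℕ) (α : KPf) : Option KPf :=
  match lastPlus (Wword n i α) with
  | some r => some (KPmove α r (r.1, i+1))
  | none => some (KPadd α (i, i+1))

/-- The operator `ẽ_i`. -/
def etilde (n i : ℕ) (α : KPf) : Option KPf :=
  match headMinus (Wword n i α) with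
  | some r => if r = (i, i+1) then some (KPsub α (i, i+1)) else some (KPmove α r (r.1, i))
  | none => none

/-- The operator `f̃_i*`. -/
def ftildeS (n i : ℕ) (α : KPf) : Option KPf :=
  match lastPlus (Wstar n i α) with
  | some r => some (KPmove α r (i, r.2))
  | none => some (KPadd α (i, i+1))

/-- The operator `ẽ_i*`. -/
def etildeS (n i : ℕ) (α : KPf) : Option KPf :=
  match headMinus (Wstar n i α) with
  | some r => if r = (i, i+1) then some (KPsub α (i, i+1)) else some (KPmove α r (i+1, r.2))
  | none => none

/-- The modified operator `f_i`. -/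
def fop (n i : ℕ) (α : KPf) : Option KPf :=
  if bStar n i α < aSt n i α then ftilde n i α
  else if 0 < aStar n i α then ftildeS n i α
  else none

/-- The modified operator `e_i`. -/
def eop (n i : ℕ) (α : KPf) : Option KPf :=
  if bStar n i α ≤ aSt n i α then
    (if 0 < bSt n i α ∧ headMinus (Wword n i α) ≠ some (i, i+1) then etilde n i α else none)
  else
    (if headMinus (Wstar n i α) ≠ some (i, i+1) then etildeS n i α else none)

/-- The operator `ê_i`. -/
def ehat (n i : ℕ) (α : KPf) : Option KPf :=
  if bStar n i α ≤ aSt n i α then (if 0 < bSt n i α then etilde n i α else none)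
  else etildeS n i α

/-- Iterate a partially defined operator (`none` plays the role of `0`). -/
def iterO (g : KPf → Option KPf) : ℕ → KPf → Option KPf
  | 0, x => some x
  | k+1, x => (g x).bind (iterO g k)

/-- `ε_i(x) = max {k : e_i^k x ≠ 0}`. -/
noncomputable def epsS (n i : ℕ) (x : KPf) : ℕ := sSup {k | iterO (eop n i) k x ≠ none}
/-- `ε̂_i(x) = max {k : ê_i^k x ≠ 0}`. -/
noncomputable def epsHatS (n i : ℕ) (x : KPf) : ℕ := sSup {k | iterO (ehat n i) k x ≠ none}
/-- `φ_i(x) = max {k : f_i^k x ≠ 0}`. -/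
noncomputable def phiS (n i : ℕ) (x : KPf) : ℕ := sSup {k | iterO (fop n i) k x ≠ none}

noncomputable def epsO (n i : ℕ) (o : Option KPf) : ℕ := o.elim 0 (epsS n i)
noncomputable def epsHatO (n i : ℕ) (o : Option KPf) : ℕ := o.elim 0 (epsHatS n i)
noncomputable def phiO (n i : ℕ) (o : Option KPf) : ℕ := o.elim 0 (phiS n i)

/-- `e_l(γ) ≃ 0`. -/
def simZero (n l : ℕ) (γ : KPf) : Prop := eop n l γ ≠ ehat n l γ

/-- `e_l e_m (γ) ≃ 0`. -/
def simZero2 (n l m : ℕ) (γ : KPf) : Prop := ∃ δ, eop n m γ = some δ ∧ simZero n l δ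

/-- The box containing all relevant pairs. -/
def kbox (n : ℕ) : Finset (ℕ × ℕ) := Finset.range (n+1) ×ˢ Finset.range (n+1)

/-- `|α|`: number of parts of the Kostant partition. -/
def kpSize (n : ℕ) (α : KPf) : ℕ := ∑ p ∈ kbox n, α p

/-- The evaluation `ᾱ ∈ ℤ^n` (as a function on 1-based coordinates). -/
def kpEval (n : ℕ) (α : KPf) : ℕ → ℤ :=
  fun k => ∑ p ∈ kbox n, (α p : ℤ) * ((if p.1 = k then 1 else 0) - (if p.2 = k then 1 else 0))

/-- The simple root `α_i = ε_i − ε_{i+1}` as a vector. -/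
def srVec (i : ℕ) : ℕ → ℤ := fun k => (if k = i then 1 else 0) - (if k = i+1 then 1 else 0)

/-- `ρ = (n-1, n-2, …, 1, 0)` (on 1-based coordinates `1..n`). -/
def rhoVec (n : ℕ) : ℕ → ℤ := fun k => (n : ℤ) - k

/-- `⟨γ, α_i^∨⟩ = γ_i − γ_{i+1}`. -/
def pairCo (γ : ℕ → ℤ) (i : ℕ) : ℤ := γ i - γ (i+1)

/-- The permutation of 1-based coordinates induced by `w : Perm (Fin n)`. -/
def extP (n : ℕ) (w : Equiv.Perm (Fin n)) (k : ℕ) : ℕ :=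
  if h : 1 ≤ k ∧ k ≤ n then ((w ⟨k - 1, by omega⟩ : Fin n) : ℕ) + 1 else k

/-- `S_n` acting on `ℤ^n` by permuting coordinates: `(w·v)_k = v_{w⁻¹(k)}`. -/
def permAct (n : ℕ) (w : Equiv.Perm (Fin n)) (v : ℕ → ℤ) : ℕ → ℤ :=
  fun k => v (extP n w⁻¹ k)

/-- The simple transposition `s_i = (i, i+1)` (1-based). -/
def sT (n i : ℕ) : Equiv.Perm (Fin n) :=
  if h : 1 ≤ i ∧ i < n then Equiv.swap ⟨i - 1, by omega⟩ ⟨i, h.2⟩ else 1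

/-- Coxeter length = number of inversions. -/
def lenP (n : ℕ) (w : Equiv.Perm (Fin n)) : ℕ :=
  (Finset.univ.filter (fun p : Fin n × Fin n => p.1 < p.2 ∧ w p.2 < w p.1)).card

/-- The left weak Bruhat order: `u ≤ w` iff `ℓ(w) = ℓ(w u⁻¹) + ℓ(u)`. -/
def leftWeakLE (n : ℕ) (u w : Equiv.Perm (Fin n)) : Prop :=
  lenP n w = lenP n (w * u⁻¹) + lenP n u

/-- `λ + ρ` as a vector. -/
def lamRho (n : ℕ) (lam : ℕ → ℤ) : ℕ → ℤ := fun k => lam k + rhoVec n k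

/-- `(w, α) ∈ S_{λ,μ}`, i.e. `ᾱ = w(λ+ρ) − (μ+ρ)`. -/
def InS (n : ℕ) (lam mu : ℕ → ℤ) (w : Equiv.Perm (Fin n)) (α : KPf) : Prop :=
  IsKP n α ∧ ∀ k, 1 ≤ k → k ≤ n →
    kpEval n α k = permAct n w (lamRho n lam) k - (mu k + rhoVec n k)

/-- A directed edge `(w,α) →^i (s_i w, β)` of the `Φ`-graph. -/
def PhiEdge (n : ℕ) (lam mu : ℕ → ℤ) (v v' : Equiv.Perm (Fin n) × KPf) : Prop :=
  InS n lam mu v.1 v.2 ∧ InS n lam mu v'.1 v'.2 ∧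
  ∃ i, 1 ≤ i ∧ i ≤ n - 1 ∧
    pairCo (permAct n v.1 (lamRho n lam)) i < 0 ∧
    v'.1 = sT n i * v.1 ∧
    iterO (fop n i) (-(pairCo (permAct n v.1 (lamRho n lam)) i)).toNat v.2 = some v'.2

/-- Being in the same connected component of (the underlying undirected graph of)
the `Φ`-graph. -/
def Conn (n : ℕ) (lam mu : ℕ → ℤ) (v v' : Equiv.Perm (Fin n) × KPf) : Prop :=
  Relation.ReflTransGen (fun a b => PhiEdge n lam mu a b ∨ PhiEdge n lam mu b a) v v'

/-- `(w,β)` has a broken hexagon, broken by `Φ_i` after `Φ_j`. -/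
def BrokenHexAt (n : ℕ) (lam mu : ℕ → ℤ) (w : Equiv.Perm (Fin n)) (β : KPf) (i j : ℕ) : Prop :=
  (j = i + 1 ∨ i = j + 1) ∧ 1 ≤ i ∧ i ≤ n - 1 ∧ 1 ≤ j ∧ j ≤ n - 1 ∧
  0 < pairCo (permAct n w (lamRho n lam)) i ∧
  0 < pairCo (permAct n w (lamRho n lam)) j ∧
  iterO (eop n i) (pairCo (permAct n w (lamRho n lam)) i).toNat β ≠ none ∧
  ∃ δ, iterO (eop n j) (pairCo (permAct n w (lamRho n lam)) j).toNat β = some δ ∧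
    epsS n i δ < (pairCo (permAct n w (lamRho n lam)) i).toNat +
      (pairCo (permAct n w (lamRho n lam)) j).toNat

/-- `γ` is obtained from `β` by an initial segment of the operator sequence
(`e_i` applied `ki` times, then `e_j` applied `ki+kj` times, then `e_i` applied
`kj` times). -/
def alongPath (n i j ki kj : ℕ) (β γ : KPf) : Prop :=
  (∃ a ≤ ki, iterO (eop n i) a β = some γ) ∨
  (∃ b ≤ ki + kj, (iterO (eop n i) ki β).bind (iterO (eop n j) b) = some γ) ∨
  (∃ c ≤ kj, ((iterO (eop n i) ki β).bind (iterO (eop n j) (ki + kj))).bind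
      (iterO (eop n i) c) = some γ)

/-- Conjecture A: no broken diamonds along the hexagon paths. -/
def ConjA (n : ℕ) (lam mu : ℕ → ℤ) : Prop :=
  ∀ (w : Equiv.Perm (Fin n)) (β : KPf) (i j : ℕ),
    InS n lam mu w β → 1 ≤ i → i ≤ n - 1 → 1 ≤ j → j ≤ n - 1 → (j = i + 1 ∨ i = j + 1) →
    ∀ ki kj : ℤ,
      ki = pairCo (permAct n w (lamRho n lam)) i →
      kj = pairCo (permAct n w (lamRho n lam)) j →
      0 < ki → 0 < kj →
      iterO (eop n i) ki.toNat β ≠ none → iterO (eop n j) kj.toNat β ≠ none →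
      ∀ γ : KPf,
        (alongPath n i j ki.toNat kj.toNat β γ ∨ alongPath n j i kj.toNat ki.toNat β γ) →
        ¬ (simZero2 n i j γ ∧ simZero2 n j i γ)

/-- Conjecture B: broken hexagons propagate up to the source vertex. -/
def ConjB (n : ℕ) (lam mu : ℕ → ℤ) : Prop :=
  ∀ (w : Equiv.Perm (Fin n)) (β α : KPf) (i j : ℕ),
    InS n lam mu w β → InS n lam mu 1 α → Conn n lam mu (1, α) (w, β) →
    BrokenHexAt n lam mu w β i j → ∃ j', BrokenHexAt n lam mu 1 α i j'

/-- The Kostka–Foulkes polynomial `K_{λ,μ}(t) = Σ_{(w,α) ∈ S_{λ,μ}} sgn(w) t^{|α|}`. -/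
noncomputable def KF (n : ℕ) (lam mu : ℕ → ℤ) : Polynomial ℤ :=
  ∑ᶠ (w : Equiv.Perm (Fin n)) (α : KPf) (_ : InS n lam mu w α),
    ((Equiv.Perm.sign w : ℤ) • (Polynomial.X ^ kpSize n α) : Polynomial ℤ)

end KFC


namespace KFC

/-! ### The reduced word of a concatenation -/

lemma reduceW_concat (w : List Entry) (e : Entry) :
    reduceW (w ++ [e]) = redStep (reduceW w) e := by
  simp [reduceW, List.foldl_append]

lemma redStep_true_concat (P M : List Entry) (r s : Root) :
    redStep (P ++ (M ++ [(false, s)])) (true, r) = P ++ M := by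
  rw [← List.append_assoc]
  simp [redStep]

lemma redStep_true_of_forall {P : List Entry} (hP : ∀ e ∈ P, e.1 = true) (r : Root) :
    redStep P (true, r) = P ++ [(true, r)] := by
  rcases List.eq_nil_or_concat P with rfl | ⟨P', ⟨b, s⟩, rfl⟩
  · simp [redStep]
  · obtain rfl : b = true := hP (b, s) (by simp)
    simp [redStep]

lemma redStep_false (l : List Entry) (r : Root) :
    redStep l (false, r) = l ++ [(false, r)] := by
  simp [redStep]

lemma reduceW_shape (w : List Entry) :
    ∃ P M : List Entry, reduceW w = P ++ M ∧ (∀ e ∈ P, e.1 = true) ∧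
      (∀ e ∈ M, e.1 = false) := by
  induction w using List.reverseRecOn with
  | nil => exact ⟨[], [], rfl, by simp, by simp⟩
  | append_singleton w e ih =>
    obtain ⟨P, M, h, hP, hM⟩ := ih
    rw [reduceW_concat, h]
    obtain ⟨b, r⟩ := e
    cases b with
    | false =>
      refine ⟨P, M ++ [(false, r)], by rw [redStep_false, List.append_assoc], hP, ?_⟩
      intro e he
      rcases List.mem_append.1 he with he | he
      · exact hM e he
      · rw [List.mem_singleton.1 he]
    | true =>
      rcases List.eq_nil_or_concat M with rfl | ⟨M', ⟨b, s⟩, rfl⟩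
      · refine ⟨P ++ [(true, r)], [], by simp [redStep_true_of_forall hP], ?_, by simp⟩
        intro e he
        rcases List.mem_append.1 he with he | he
        · exact hP e he
        · rw [List.mem_singleton.1 he]
      · obtain rfl : b = false := hM (b, s) (by simp)
        refine ⟨P, M', ?_, hP, fun e he => hM e (by simp [he])⟩
        rw [List.concat_eq_append, redStep_true_concat]

lemma filter_plus_append {P M : List Entry} (hP : ∀ e ∈ P, e.1 = true)
    (hM : ∀ e ∈ M, e.1 = false) : (P ++ M).filter (fun e => e.1) = P := by
  rw [List.filter_append, List.filter_eq_self.2 hP, List.filter_eq_nil_iff.2, List.append_nil]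
  intro e he
  simp [hM e he]

lemma filter_minus_append {P M : List Entry} (hP : ∀ e ∈ P, e.1 = true)
    (hM : ∀ e ∈ M, e.1 = false) : (P ++ M).filter (fun e => !e.1) = M := by
  rw [List.filter_append, List.filter_eq_nil_iff.2, List.nil_append, List.filter_eq_self.2]
  · intro e he
    simp [hM e he]
  · intro e he
    simp [hP e he]

lemma stats_concat_true (w : List Entry) (r : Root) :
    plusCt (reduceW (w ++ [(true, r)])) = plusCt (reduceW w) + (1 - minusCt (reduceW w)) ∧
    minusCt (reduceW (w ++ [(true, r)])) = minusCt (reduceW w) - 1 ∧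
    headMinus (w ++ [(true, r)]) =
      if 1 < minusCt (reduceW w) then headMinus w else none := by
  obtain ⟨P, M, h, hP, hM⟩ := reduceW_shape w
  unfold headMinus plusCt minusCt
  rw [reduceW_concat, h]
  rcases List.eq_nil_or_concat M with rfl | ⟨M', ⟨b, s⟩, rfl⟩
  · have hP' : ∀ e ∈ P ++ [((true, r) : Entry)], e.1 = true := by
      intro e he
      rcases List.mem_append.1 he with he | he
      · exact hP e he
      · rw [List.mem_singleton.1 he]
    have h1 := filter_plus_append hP' (M := []) (by simp)
    have h2 := filter_minus_append hP' (M := []) (by simp)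
    rw [List.append_nil] at h1 h2
    rw [filter_plus_append hP hM, filter_minus_append hP hM, List.append_nil,
      redStep_true_of_forall hP, h1, h2]
    simp
  · obtain rfl : b = false := hM (b, s) (by simp)
    have hM' : ∀ e ∈ M', e.1 = false := fun e he => hM e (by simp [he])
    rw [filter_plus_append hP hM, filter_minus_append hP hM]
    rw [List.concat_eq_append, redStep_true_concat, filter_plus_append hP hM',
      filter_minus_append hP hM']
    cases M' <;> simp

lemma stats_concat_false (w : List Entry) (r : Root) :
    plusCt (reduceW (w ++ [(false, r)])) = plusCt (reduceW w) ∧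
    minusCt (reduceW (w ++ [(false, r)])) = minusCt (reduceW w) + 1 ∧
    headMinus (w ++ [(false, r)]) =
      if 0 < minusCt (reduceW w) then headMinus w else some r := by
  obtain ⟨P, M, h, hP, hM⟩ := reduceW_shape w
  unfold headMinus plusCt minusCt
  have hM' : ∀ e ∈ M ++ [((false, r) : Entry)], e.1 = false := by
    intro e he
    rcases List.mem_append.1 he with he | he
    · exact hM e he
    · rw [List.mem_singleton.1 he]
  rw [reduceW_concat, h, redStep_false, List.append_assoc, filter_plus_append hP hM,
    filter_minus_append hP hM, filter_plus_append hP hM', filter_minus_append hP hM']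
  cases M <;> simp

lemma stats_append (u v : List Entry) :
    plusCt (reduceW (u ++ v)) =
      plusCt (reduceW u) + (plusCt (reduceW v) - minusCt (reduceW u)) ∧
    minusCt (reduceW (u ++ v)) =
      minusCt (reduceW v) + (minusCt (reduceW u) - plusCt (reduceW v)) ∧
    headMinus (u ++ v) =
      if plusCt (reduceW v) < minusCt (reduceW u) then headMinus u else headMinus v := by
  induction v using List.reverseRecOn with
  | nil =>
    obtain ⟨P, M, h, hP, hM⟩ := reduceW_shape u
    simp only [List.append_nil, headMinus, plusCt, minusCt, h, filter_plus_append hP hM,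
      filter_minus_append hP hM]
    cases M <;> simp [reduceW]
  | append_singleton v e ih =>
    obtain ⟨h1, h2, h3⟩ := ih
    obtain ⟨b, r⟩ := e
    rw [← List.append_assoc]
    cases b with
    | true =>
      obtain ⟨k1, k2, k3⟩ := stats_concat_true v r
      obtain ⟨l1, l2, l3⟩ := stats_concat_true (u ++ v) r
      rw [k1, k2, k3, l1, l2, l3, h1, h2, h3]
      refine ⟨by omega, by omega, ?_⟩
      split_ifs <;> first | rfl | omega
    | false =>
      obtain ⟨k1, k2, k3⟩ := stats_concat_false v r
      obtain ⟨l1, l2, l3⟩ := stats_concat_false (u ++ v) r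
      rw [k1, k2, k3, l1, l2, l3, h1, h2, h3]
      refine ⟨by omega, by omega, ?_⟩
      split_ifs <;> first | rfl | omega

lemma headMinus_ne_none_iff (w : List Entry) :
    headMinus w ≠ none ↔ 0 < minusCt (reduceW w) := by
  unfold headMinus minusCt
  cases (reduceW w).filter (fun e => !e.1) <;> simp

/-! ### Words built from blocks `+ ⋯ + − ⋯ −` -/

/-- The word with a block of `p k` symbols '+' followed by `m k` symbols '−' for each index `k`
of the list `L`. -/
def blockWord (L : List ℕ) (p m : ℕ → ℕ) (lp lm : ℕ → Root) : List Entry :=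
  L.flatMap (fun k =>
    List.replicate (p k) ((true, lp k) : Entry) ++ List.replicate (m k) ((false, lm k) : Entry))

lemma stats_replicate_true (x : ℕ) (r : Root) :
    plusCt (reduceW (List.replicate x ((true, r) : Entry))) = x ∧
    minusCt (reduceW (List.replicate x ((true, r) : Entry))) = 0 ∧
    headMinus (List.replicate x ((true, r) : Entry)) = none := by
  induction x with
  | zero => simp [reduceW, plusCt, minusCt, headMinus]
  | succ x ih =>
    obtain ⟨h1, h2, h3⟩ := ih
    rw [List.replicate_succ']
    obtain ⟨k1, k2, k3⟩ := stats_concat_true (List.replicate x ((true, r) : Entry)) r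
    rw [k1, k2, k3, h1, h2]
    simp

lemma stats_replicate_false (x : ℕ) (r : Root) :
    plusCt (reduceW (List.replicate x ((false, r) : Entry))) = 0 ∧
    minusCt (reduceW (List.replicate x ((false, r) : Entry))) = x ∧
    headMinus (List.replicate x ((false, r) : Entry)) = if 0 < x then some r else none := by
  induction x with
  | zero => simp [reduceW, plusCt, minusCt, headMinus]
  | succ x ih =>
    obtain ⟨h1, h2, h3⟩ := ih
    rw [List.replicate_succ']
    obtain ⟨k1, k2, k3⟩ := stats_concat_false (List.replicate x ((false, r) : Entry)) r
    rw [k1, k2, k3, h1, h2, h3]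
    refine ⟨rfl, rfl, ?_⟩
    split_ifs <;> first | rfl | omega

lemma stats_block (x y : ℕ) (r s : Root) :
    plusCt (reduceW (List.replicate x ((true, r) : Entry) ++
      List.replicate y ((false, s) : Entry))) = x ∧
    minusCt (reduceW (List.replicate x ((true, r) : Entry) ++
      List.replicate y ((false, s) : Entry))) = y ∧
    headMinus (List.replicate x ((true, r) : Entry) ++
      List.replicate y ((false, s) : Entry)) = if 0 < y then some s else none := by
  obtain ⟨h1, h2, h3⟩ := stats_append (List.replicate x ((true, r) : Entry))
    (List.replicate y ((false, s) : Entry))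
  obtain ⟨k1, k2, k3⟩ := stats_replicate_true x r
  obtain ⟨l1, l2, l3⟩ := stats_replicate_false y s
  rw [h1, h2, h3, k1, k2, k3, l1, l2, l3]
  simp

lemma headMinus_blockWord {L : List ℕ} {p m : ℕ → ℕ} {lp lm : ℕ → Root} {r : Root}
    (h : headMinus (blockWord L p m lp lm) = some r) : ∃ k ∈ L, r = lm k ∧ 0 < m k := by
  induction L with
  | nil => simp [blockWord, headMinus, reduceW] at h
  | cons k L ih =>
    rw [blockWord, List.flatMap_cons, (stats_append _ _).2.2] at h
    split_ifs at h with hlt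
    · rw [(stats_block _ _ _ _).2.2] at h
      split_ifs at h with h0
      exact ⟨k, by simp, (Option.some.inj h).symm, h0⟩
    · obtain ⟨k', hk', hr⟩ := ih h
      exact ⟨k', by simp [hk'], hr⟩

lemma blockWord_congr {L : List ℕ} {p m p' m' : ℕ → ℕ} (lp lm : ℕ → Root)
    (hp : ∀ k ∈ L, p k = p' k) (hm : ∀ k ∈ L, m k = m' k) :
    blockWord L p m lp lm = blockWord L p' m' lp lm := by
  unfold blockWord
  refine List.flatMap_congr fun k hk => ?_
  rw [hp k hk, hm k hk]

lemma stats_two_blocks (c d : ℕ) (p m : ℕ → ℕ) (lp lm : ℕ → Root) :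
    plusCt (reduceW (blockWord [c, d] p m lp lm)) = p c + (p d - m c) ∧
    minusCt (reduceW (blockWord [c, d] p m lp lm)) = m d + (m c - p d) ∧
    (0 < m d + (m c - p d) →
      headMinus (blockWord [c, d] p m lp lm) = some (lm (if p d < m c then c else d))) := by
  simp only [blockWord, List.flatMap_cons, List.flatMap_nil, List.append_nil]
  obtain ⟨h1, h2, h3⟩ := stats_append
    (List.replicate (p c) ((true, lp c) : Entry) ++ List.replicate (m c) ((false, lm c) : Entry))
    (List.replicate (p d) ((true, lp d) : Entry) ++ List.replicate (m d) ((false, lm d) : Entry))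
  obtain ⟨k1, k2, k3⟩ := stats_block (p c) (m c) (lp c) (lm c)
  obtain ⟨l1, l2, l3⟩ := stats_block (p d) (m d) (lp d) (lm d)
  rw [h1, h2, h3, k1, k2, k3, l1, l2, l3]
  refine ⟨rfl, rfl, fun hpos => ?_⟩
  split_ifs <;> first | rfl | omega

/-- Changing two adjacent blocks without changing their joint reduced sign pattern does not
change the sign pattern of the reduced word, and the leftmost surviving '−' either stays where it
is, away from the two blocks, or stays within the two blocks. -/
lemma blockWord_stable {L₁ L₂ : List ℕ} {c d : ℕ} {p m p' m' : ℕ → ℕ} {lp lm : ℕ → Root}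
    (hlm : Function.Injective lm)
    (hc₁ : c ∉ L₁) (hd₁ : d ∉ L₁) (hc₂ : c ∉ L₂) (hd₂ : d ∉ L₂)
    (hp : ∀ k, k ≠ c → k ≠ d → p k = p' k) (hm : ∀ k, k ≠ c → k ≠ d → m k = m' k)
    (ha : p c + (p d - m c) = p' c + (p' d - m' c))
    (hb : m d + (m c - p d) = m' d + (m' c - p' d)) :
    plusCt (reduceW (blockWord (L₁ ++ c :: d :: L₂) p' m' lp lm)) =
      plusCt (reduceW (blockWord (L₁ ++ c :: d :: L₂) p m lp lm)) ∧
    minusCt (reduceW (blockWord (L₁ ++ c :: d :: L₂) p' m' lp lm)) =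
      minusCt (reduceW (blockWord (L₁ ++ c :: d :: L₂) p m lp lm)) ∧
    ((headMinus (blockWord (L₁ ++ c :: d :: L₂) p' m' lp lm) =
        headMinus (blockWord (L₁ ++ c :: d :: L₂) p m lp lm) ∧
      headMinus (blockWord (L₁ ++ c :: d :: L₂) p m lp lm) ≠ some (lm c) ∧
      headMinus (blockWord (L₁ ++ c :: d :: L₂) p m lp lm) ≠ some (lm d)) ∨
     (headMinus (blockWord (L₁ ++ c :: d :: L₂) p m lp lm) =
        some (lm (if p d < m c then c else d)) ∧
      headMinus (blockWord (L₁ ++ c :: d :: L₂) p' m' lp lm) =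
        some (lm (if p' d < m' c then c else d)))) := by
  have hsplit : ∀ q r : ℕ → ℕ, blockWord (L₁ ++ c :: d :: L₂) q r lp lm =
      blockWord L₁ q r lp lm ++ (blockWord [c, d] q r lp lm ++ blockWord L₂ q r lp lm) := by
    intro q r
    simp [blockWord]
  have hne : ∀ L : List ℕ, c ∉ L → d ∉ L → ∀ q r : ℕ → ℕ,
      headMinus (blockWord L q r lp lm) ≠ some (lm c) ∧
      headMinus (blockWord L q r lp lm) ≠ some (lm d) := by
    intro L hc hd q r
    constructor <;>
    · intro h
      obtain ⟨k, hk, hlk, -⟩ := headMinus_blockWord h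
      cases hlm hlk
      contradiction
  have e₁ : blockWord L₁ p m lp lm = blockWord L₁ p' m' lp lm := by
    refine blockWord_congr lp lm (fun k hk => hp k ?_ ?_) (fun k hk => hm k ?_ ?_) <;>
    · rintro rfl; contradiction
  have e₂ : blockWord L₂ p m lp lm = blockWord L₂ p' m' lp lm := by
    refine blockWord_congr lp lm (fun k hk => hp k ?_ ?_) (fun k hk => hm k ?_ ?_) <;>
    · rintro rfl; contradiction
  rw [hsplit p m, hsplit p' m', e₁, e₂]
  obtain ⟨u1, u2, u3⟩ := stats_two_blocks c d p m lp lm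
  obtain ⟨v1, v2, v3⟩ := stats_two_blocks c d p' m' lp lm
  simp only [(stats_append _ _).1, (stats_append _ _).2.1, (stats_append _ _).2.2, u1, u2, v1, v2,
    ha, hb]
  refine ⟨trivial, trivial, ?_⟩
  rw [hb] at u3
  generalize hx : (if p d < m c then c else d) = x at u3 ⊢
  generalize hy : (if p' d < m' c then c else d) = y at v3 ⊢
  split_ifs with g1 g2
  · exact Or.inl ⟨rfl, hne L₁ hc₁ hd₁ _ _⟩
  · exact Or.inr ⟨u3 (by omega), v3 (by omega)⟩
  · exact Or.inl ⟨rfl, hne L₂ hc₂ hd₂ _ _⟩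

/-! ### The words `W_i` and `W_i*` -/

lemma Wword_eq_blockWord (n i : ℕ) (α : KPf) :
    Wword n i α = blockWord (List.range (n+1)).reverse (fun h => α (h, i)) (fun h => α (h, i+1))
      (fun h => (h, i)) (fun h => (h, i+1)) := rfl

lemma Wstar_eq_blockWord (n i : ℕ) (α : KPf) :
    Wstar n i α = blockWord (List.range (n+1)) (fun j => α (i+1, j)) (fun j => α (i, j))
      (fun j => (i+1, j)) (fun j => (i, j)) := rfl

lemma headMinus_Wword {n i : ℕ} {α : KPf} {r : Root} (h : headMinus (Wword n i α) = some r) :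
    r.2 = i + 1 ∧ 0 < α r := by
  obtain ⟨k, -, rfl, hk⟩ := headMinus_blockWord h
  exact ⟨rfl, hk⟩

lemma headMinus_Wstar {n i : ℕ} {α : KPf} {r : Root} (h : headMinus (Wstar n i α) = some r) :
    r.1 = i ∧ 0 < α r := by
  obtain ⟨k, -, rfl, hk⟩ := headMinus_blockWord h
  exact ⟨rfl, hk⟩

lemma Wword_congr (n : ℕ) {i : ℕ} {α β : KPf} (h : ∀ p : Root, p.2 = i ∨ p.2 = i + 1 → α p = β p) :
    Wword n i α = Wword n i β :=
  blockWord_congr _ _ (fun _ _ => h _ (Or.inl rfl)) (fun _ _ => h _ (Or.inr rfl))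

lemma Wstar_congr (n : ℕ) {i : ℕ} {α β : KPf} (h : ∀ p : Root, p.1 = i ∨ p.1 = i + 1 → α p = β p) :
    Wstar n i α = Wstar n i β :=
  blockWord_congr _ _ (fun _ _ => h _ (Or.inr rfl)) (fun _ _ => h _ (Or.inl rfl))

lemma range_split {n j : ℕ} (hj : j + 1 ≤ n) :
    ∃ L₁ L₂ : List ℕ, List.range (n+1) = L₁ ++ j :: (j+1) :: L₂ ∧
      j ∉ L₁ ∧ j + 1 ∉ L₁ ∧ j ∉ L₂ ∧ j + 1 ∉ L₂ := by
  refine ⟨List.range' 0 j, List.range' (j+2) (n-1-j), ?_, ?_, ?_, ?_, ?_⟩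
  · rw [List.range_eq_range', show n + 1 = j + (n - 1 - j + 1 + 1) by omega,
      ← List.range'_append_1, List.range'_succ, List.range'_succ, Nat.zero_add]
  all_goals
    rw [List.mem_range'_1]
    omega

/-- The leftmost surviving '−' of `W_j`, if it is in row `i` or `i+1`, is in row `i+1` precisely
when `α (i, j) < α (i+1, j+1)`. -/
lemma headMinus_Wword_row {n i j h : ℕ} {α : KPf} (hi : i + 1 ≤ n)
    (hh : headMinus (Wword n j α) = some (h, j+1)) (hr : h = i ∨ h = i + 1) :
    h = if α (i, j) < α (i+1, j+1) then i + 1 else i := by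
  obtain ⟨L₁, L₂, hL, h1, h2, h3, h4⟩ := range_split hi
  have hL' : (List.range (n+1)).reverse = L₂.reverse ++ (i+1) :: i :: L₁.reverse := by
    rw [hL]; simp
  have key := (blockWord_stable (L₁ := L₂.reverse) (L₂ := L₁.reverse) (c := i+1) (d := i)
    (p := fun h => α (h, j)) (m := fun h => α (h, j+1)) (p' := fun h => α (h, j))
    (m' := fun h => α (h, j+1)) (lp := fun h => (h, j)) (lm := fun h => (h, j+1))
    (fun a b hab => (Prod.mk.inj hab).1) (by simpa) (by simpa) (by simpa) (by simpa)
    (fun _ _ _ => rfl) (fun _ _ _ => rfl) rfl rfl).2.2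
  rw [← hL', ← Wword_eq_blockWord, hh] at key
  rcases key with ⟨-, k1, k2⟩ | ⟨k1, -⟩
  · rcases hr with rfl | rfl <;> simp at k1 k2
  · exact (Prod.mk.inj (Option.some.inj k1)).1

lemma headMinus_Wstar_col {n i j b : ℕ} {α : KPf} (hj : j + 1 ≤ n)
    (hh : headMinus (Wstar n i α) = some (i, b)) (hr : b = j ∨ b = j + 1) :
    b = if α (i+1, j+1) < α (i, j) then j else j + 1 := by
  obtain ⟨L₁, L₂, hL, h1, h2, h3, h4⟩ := range_split hj
  have key := (blockWord_stable (L₁ := L₁) (L₂ := L₂) (c := j) (d := j+1)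
    (p := fun h => α (i+1, h)) (m := fun h => α (i, h)) (p' := fun h => α (i+1, h))
    (m' := fun h => α (i, h)) (lp := fun h => (i+1, h)) (lm := fun h => (i, h))
    (fun a b hab => (Prod.mk.inj hab).2) h1 h2 h3 h4
    (fun _ _ _ => rfl) (fun _ _ _ => rfl) rfl rfl).2.2
  rw [← hL, ← Wstar_eq_blockWord, hh] at key
  rcases key with ⟨-, k1, k2⟩ | ⟨k1, -⟩
  · rcases hr with rfl | rfl <;> simp at k1 k2
  · exact (Prod.mk.inj (Option.some.inj k1)).2

lemma KPmove_apply (α : KPf) (r r' p : Root) :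
    KPmove α r r' p = (if p = r then α p - 1 else α p) + if p = r' then 1 else 0 := by
  simp only [KPmove, KPadd, KPsub]
  split_ifs <;> rfl

lemma KPmove_of_ne (α : KPf) {r r' p : Root} (h₁ : p ≠ r) (h₂ : p ≠ r') :
    KPmove α r r' p = α p := by
  simp [KPmove_apply, h₁, h₂]

/-- The column move `(h,j+1) ↦ (h,j)` at the leftmost surviving '−' of `W_j` does not change the
sign pattern of the reduced word of `W_i*`. -/
lemma Wstar_col_move {n i j h : ℕ} {α : KPf} (hi : i + 1 ≤ n) (hj : j + 1 ≤ n)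
    (hh : headMinus (Wword n j α) = some (h, j+1)) :
    bStar n i (KPmove α (h, j+1) (h, j)) = bStar n i α ∧
    ((headMinus (Wstar n i (KPmove α (h, j+1) (h, j))) = headMinus (Wstar n i α) ∧
      (h = i ∨ h = i + 1 → headMinus (Wstar n i α) ≠ some (i, j) ∧
        headMinus (Wstar n i α) ≠ some (i, j+1))) ∨
     ((h = i ∨ h = i + 1) ∧
      headMinus (Wstar n i α) =
        some (i, if α (i+1, j+1) < α (i, j) then j else j + 1) ∧
      headMinus (Wstar n i (KPmove α (h, j+1) (h, j))) =
        some (i, if KPmove α (h, j+1) (h, j) (i+1, j+1) < KPmove α (h, j+1) (h, j) (i, j)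
          then j else j + 1))) := by
  by_cases hr : h = i ∨ h = i + 1
  · obtain ⟨L₁, L₂, hL, h1, h2, h3, h4⟩ := range_split hj
    have hpos := (headMinus_Wword hh).2
    have hrow := headMinus_Wword_row hi hh hr
    have key := blockWord_stable (L₁ := L₁) (L₂ := L₂) (c := j) (d := j+1)
      (p := fun k => α (i+1, k)) (m := fun k => α (i, k))
      (p' := fun k => KPmove α (h, j+1) (h, j) (i+1, k))
      (m' := fun k => KPmove α (h, j+1) (h, j) (i, k))
      (lp := fun k => (i+1, k)) (lm := fun k => (i, k))
      (fun a b hab => (Prod.mk.inj hab).2) h1 h2 h3 h4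
      (fun k k1 k2 => (KPmove_of_ne α (by simp [k2]) (by simp [k1])).symm)
      (fun k k1 k2 => (KPmove_of_ne α (by simp [k2]) (by simp [k1])).symm)
      (by
        rcases hr with rfl | rfl <;> simp [KPmove_apply] at hrow ⊢ <;> omega)
      (by
        rcases hr with rfl | rfl <;> simp [KPmove_apply] at hrow ⊢ <;> omega)
    rw [← hL, ← Wstar_eq_blockWord, ← Wstar_eq_blockWord] at key
    refine ⟨key.2.1, ?_⟩
    rcases key.2.2 with k | k
    · exact Or.inl ⟨k.1, fun _ => k.2⟩
    · exact Or.inr ⟨hr, k⟩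
  · have e : Wstar n i (KPmove α (h, j+1) (h, j)) = Wstar n i α := by
      refine Wstar_congr n fun p hp => KPmove_of_ne α ?_ ?_ <;>
      · rintro rfl; exact hr hp
    exact ⟨by rw [bStar, e, bStar], Or.inl ⟨by rw [e], fun h => absurd h hr⟩⟩

/-- The row move `(i,b) ↦ (i+1,b)` at the leftmost surviving '−' of `W_i*` does not change the
sign pattern of the reduced word of `W_j`. -/
lemma Wword_row_move {n i j b : ℕ} {α : KPf} (hi : i + 1 ≤ n) (hj : j + 1 ≤ n)
    (hh : headMinus (Wstar n i α) = some (i, b)) :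
    aSt n j (KPmove α (i, b) (i+1, b)) = aSt n j α ∧
    ((headMinus (Wword n j (KPmove α (i, b) (i+1, b))) = headMinus (Wword n j α) ∧
      (b = j ∨ b = j + 1 → headMinus (Wword n j α) ≠ some (i+1, j+1) ∧
        headMinus (Wword n j α) ≠ some (i, j+1))) ∨
     ((b = j ∨ b = j + 1) ∧
      headMinus (Wword n j α) =
        some (if α (i, j) < α (i+1, j+1) then i + 1 else i, j+1) ∧
      headMinus (Wword n j (KPmove α (i, b) (i+1, b))) =
        some (if KPmove α (i, b) (i+1, b) (i, j) < KPmove α (i, b) (i+1, b) (i+1, j+1)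
          then i + 1 else i, j+1))) := by
  by_cases hr : b = j ∨ b = j + 1
  · obtain ⟨L₁, L₂, hL, h1, h2, h3, h4⟩ := range_split hi
    have hL' : (List.range (n+1)).reverse = L₂.reverse ++ (i+1) :: i :: L₁.reverse := by
      rw [hL]; simp
    have hpos := (headMinus_Wstar hh).2
    have hcol := headMinus_Wstar_col hj hh hr
    have key := blockWord_stable (L₁ := L₂.reverse) (L₂ := L₁.reverse) (c := i+1) (d := i)
      (p := fun k => α (k, j)) (m := fun k => α (k, j+1))
      (p' := fun k => KPmove α (i, b) (i+1, b) (k, j))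
      (m' := fun k => KPmove α (i, b) (i+1, b) (k, j+1))
      (lp := fun k => (k, j)) (lm := fun k => (k, j+1))
      (fun a b hab => (Prod.mk.inj hab).1) (by simpa) (by simpa) (by simpa) (by simpa)
      (fun k k1 k2 => (KPmove_of_ne α (by simp [k2]) (by simp [k1])).symm)
      (fun k k1 k2 => (KPmove_of_ne α (by simp [k2]) (by simp [k1])).symm)
      (by
        rcases hr with rfl | rfl <;> simp [KPmove_apply] at hcol ⊢ <;> omega)
      (by
        rcases hr with rfl | rfl <;> simp [KPmove_apply] at hcol ⊢ <;> omega)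
    rw [← hL', ← Wword_eq_blockWord, ← Wword_eq_blockWord] at key
    refine ⟨key.1, ?_⟩
    rcases key.2.2 with k | k
    · exact Or.inl ⟨k.1, fun _ => k.2⟩
    · exact Or.inr ⟨hr, k⟩
  · have e : Wword n j (KPmove α (i, b) (i+1, b)) = Wword n j α := by
      refine Wword_congr n fun p hp => KPmove_of_ne α ?_ ?_ <;>
      · rintro rfl; exact hr hp
    exact ⟨by rw [aSt, e, aSt], Or.inl ⟨by rw [e], fun h => absurd h hr⟩⟩

/-! ### The operators `e_i` -/

lemma eop_eq_some_iff (n i : ℕ) (α β : KPf) :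
    eop n i α = some β ↔
      (bStar n i α ≤ aSt n i α ∧ ∃ h, h ≠ i ∧ headMinus (Wword n i α) = some (h, i+1) ∧
        β = KPmove α (h, i+1) (h, i)) ∨
      (aSt n i α < bStar n i α ∧ ∃ b, b ≠ i + 1 ∧ headMinus (Wstar n i α) = some (i, b) ∧
        β = KPmove α (i, b) (i+1, b)) := by
  unfold eop
  by_cases hc : bStar n i α ≤ aSt n i α
  · rw [if_pos hc, etilde]
    simp only [bSt, ← headMinus_ne_none_iff, hc, not_lt.2 hc, true_and, false_and, or_false]
    rcases hh : headMinus (Wword n i α) with _ | ⟨h, k⟩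
    · simp
    · obtain rfl : k = i + 1 := (headMinus_Wword hh).1
      by_cases hhi : h = i
      · subst hhi
        simp
      · simp only [reduceCtorEq, ne_eq, not_false_eq_true, Option.some.injEq, Prod.mk.injEq, hhi,
          and_self, if_true, if_false, and_true]
        exact ⟨fun e => ⟨h, hhi, rfl, e.symm⟩, fun ⟨_, _, e, e'⟩ => by rw [e', e]⟩
  · rw [if_neg hc, etildeS]
    simp only [hc, not_le.1 hc, true_and, false_and, false_or]
    rcases hh : headMinus (Wstar n i α) with _ | ⟨k, b⟩
    · simp
    · obtain rfl : k = i := (headMinus_Wstar hh).1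
      by_cases hb : b = k + 1
      · subst hb
        simp
      · simp [hb, eq_comm]

lemma IsKP.move {n : ℕ} {α : KPf} (hα : IsKP n α) {r r' : Root} (hr : IsPos n r') :
    IsKP n (KPmove α r r') := by
  intro p hp
  by_cases h : p = r'
  · rwa [h]
  · refine hα p fun h0 => hp ?_
    simp [KPmove_apply, h, h0]

lemma IsKP.eop {n i : ℕ} {α β : KPf} (hα : IsKP n α) (hi : 1 ≤ i)
    (h : eop n i α = some β) : IsKP n β := by
  rcases (eop_eq_some_iff n i α β).1 h with ⟨-, h, hne, hh, rfl⟩ | ⟨-, b, hne, hh, rfl⟩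
  · have := hα _ (headMinus_Wword hh).2.ne'
    refine hα.move ?_
    simp only [IsPos] at this ⊢
    omega
  · have := hα _ (headMinus_Wstar hh).2.ne'
    refine hα.move ?_
    simp only [IsPos] at this ⊢
    omega

lemma KPmove_comm {α : KPf} {r r' s s' : Root} (hr : 0 < α r) (hs : 0 < α s)
    (hrr : r ≠ r') (hss : s ≠ s') :
    KPmove (KPmove α r r') s s' = KPmove (KPmove α s s') r r' := by
  funext p
  have h1 : p = r → 0 < α p := fun h => h ▸ hr
  have h2 : p = s → 0 < α p := fun h => h ▸ hs
  simp only [KPmove_apply]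
  grind

lemma KPmove_KPmove {α : KPf} {r s u : Root} (hr : 0 < α r) :
    KPmove (KPmove α r s) s u = KPmove α r u := by
  funext p
  have h1 : p = r → 0 < α p := fun h => h ▸ hr
  simp only [KPmove_apply]
  split_ifs <;> simp_all

/-- A column move at `j` and a row move at `i`, performed in either order. -/
lemma row_col_diamond {n i j h b : ℕ} {α : KPf} (hi : i + 1 ≤ n) (hj : j + 1 ≤ n)
    (hN : headMinus (Wword n j α) = some (h, j+1))
    (hS : headMinus (Wstar n i α) = some (i, b)) (hhj : h < j) (hbi : i + 1 < b)
    (hij : i + 1 < j) :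
    ∃ b' h', b' ≠ i + 1 ∧ h' ≠ j ∧
      headMinus (Wstar n i (KPmove α (h, j+1) (h, j))) = some (i, b') ∧
      headMinus (Wword n j (KPmove α (i, b) (i+1, b))) = some (h', j+1) ∧
      KPmove (KPmove α (h, j+1) (h, j)) (i, b') (i+1, b') =
        KPmove (KPmove α (i, b) (i+1, b)) (h', j+1) (h', j) := by
  have hposN := (headMinus_Wword hN).2
  have hposS := (headMinus_Wstar hS).2
  by_cases hmid : (h = i ∨ h = i + 1) ∧ (b = j ∨ b = j + 1)
  · obtain ⟨hh, hb⟩ := hmid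
    have hrow := headMinus_Wword_row hi hN hh
    have hcol := headMinus_Wstar_col hj hS hb
    have A : headMinus (Wstar n i (KPmove α (h, j+1) (h, j))) =
        some (i, if KPmove α (h, j+1) (h, j) (i+1, j+1) < KPmove α (h, j+1) (h, j) (i, j)
          then j else j + 1) := by
      rcases (Wstar_col_move hi hj hN).2 with ⟨-, k⟩ | ⟨-, -, k⟩
      · have k := k hh
        rw [hS] at k
        rcases hb with rfl | rfl <;> simp at k
      · exact k
    have B : headMinus (Wword n j (KPmove α (i, b) (i+1, b))) =
        some (if KPmove α (i, b) (i+1, b) (i, j) < KPmove α (i, b) (i+1, b) (i+1, j+1)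
          then i + 1 else i, j+1) := by
      rcases (Wword_row_move hi hj hS).2 with ⟨-, k⟩ | ⟨-, -, k⟩
      · have k := k hb
        rw [hN] at k
        rcases hh with rfl | rfl <;> simp at k
      · exact k
    refine ⟨_, _, ?_, ?_, A, B, ?_⟩
    · split_ifs <;> omega
    · split_ifs <;> omega
    · rcases lt_trichotomy (α (i, j)) (α (i+1, j+1)) with hlt | heq | hlt
      · rw [if_pos hlt] at hrow
        rw [if_neg hlt.le.not_gt] at hcol
        subst hrow hcol
        rw [if_neg (by simp [KPmove_apply]; omega), if_pos (by simp [KPmove_apply]; omega)]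
        exact KPmove_comm hposN hposS (by simp) (by simp)
      · rw [if_neg heq.not_lt] at hrow
        rw [if_neg heq.not_gt] at hcol
        subst hrow hcol
        rw [if_pos (by simp [KPmove_apply]; omega), if_pos (by simp [KPmove_apply]; omega)]
        rw [KPmove_KPmove hposN, KPmove_KPmove hposS]
      · rw [if_neg hlt.le.not_gt] at hrow
        rw [if_pos hlt] at hcol
        subst hrow hcol
        rw [if_pos (by simp [KPmove_apply]; omega), if_neg (by simp [KPmove_apply]; omega)]
        exact KPmove_comm hposN hposS (by simp) (by simp)
  · refine ⟨b, h, by omega, by omega, ?_, ?_, KPmove_comm hposN hposS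
          (by simp) (by simp)⟩
    · rcases (Wstar_col_move hi hj hN).2 with ⟨k, -⟩ | ⟨hh, k, -⟩
      · rw [k, hS]
      · rw [hS] at k
        have := (Prod.mk.inj (Option.some.inj k)).2
        refine absurd ⟨hh, ?_⟩ hmid
        split_ifs at this <;> omega
    · rcases (Wword_row_move hi hj hS).2 with ⟨k, -⟩ | ⟨hb, k, -⟩
      · rw [k, hN]
      · rw [hN] at k
        have := (Prod.mk.inj (Option.some.inj k)).1
        refine absurd ⟨?_, hb⟩ hmid
        split_ifs at this <;> omega

lemma eop_diamond_of_lt {n i j : ℕ} {α β γ : KPf} (hα : IsKP n α) (hj : j + 1 ≤ n)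
    (hij : i + 1 < j) (hβ : eop n i α = some β) (hγ : eop n j α = some γ) :
    ∃ δ, eop n j β = some δ ∧ eop n i γ = some δ := by
  have hi : i + 1 ≤ n := by omega
  rcases (eop_eq_some_iff n i α β).1 hβ with ⟨hci, h, hne, hh, rfl⟩ | ⟨hci, b, hne, hh, rfl⟩
  · have hposi := (headMinus_Wword hh).2
    have hroot := hα _ hposi.ne'
    simp only [IsPos] at hroot
    have w1 : Wword n j (KPmove α (h, i+1) (h, i)) = Wword n j α := by
      refine Wword_congr n fun p hp => KPmove_of_ne α ?_ ?_ <;>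
      · rintro rfl; simp at hp; omega
    have w2 : Wstar n j (KPmove α (h, i+1) (h, i)) = Wstar n j α := by
      refine Wstar_congr n fun p hp => KPmove_of_ne α ?_ ?_ <;>
      · rintro rfl; simp at hp; omega
    rcases (eop_eq_some_iff n j α γ).1 hγ with ⟨hcj, k, knej, kh, rfl⟩ | ⟨hcj, k, knej, kh, rfl⟩
    · have hposj := (headMinus_Wword kh).2
      refine ⟨_, (eop_eq_some_iff _ _ _ _).2 (Or.inl ⟨?_, k, knej, by rw [w1, kh], rfl⟩),
        (eop_eq_some_iff _ _ _ _).2 (Or.inl ⟨?_, h, hne, ?_, KPmove_comm hposi hposj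
          (by simp) (by simp)⟩)⟩
      · rwa [bStar, aSt, w1, w2]
      all_goals
        have w3 : Wword n i (KPmove α (k, j+1) (k, j)) = Wword n i α := by
          refine Wword_congr n fun p hp => KPmove_of_ne α ?_ ?_ <;>
          · rintro rfl; simp at hp; omega
      · rwa [(Wstar_col_move hi hj kh).1, aSt, w3]
      · rw [w3, hh]
    · have hposj := (headMinus_Wstar kh).2
      have hrootj := hα _ hposj.ne'
      simp only [IsPos] at hrootj
      have w3 : Wword n i (KPmove α (j, k) (j+1, k)) = Wword n i α := by
        refine Wword_congr n fun p hp => KPmove_of_ne α ?_ ?_ <;>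
        · rintro rfl; simp at hp; omega
      have w4 : Wstar n i (KPmove α (j, k) (j+1, k)) = Wstar n i α := by
        refine Wstar_congr n fun p hp => KPmove_of_ne α ?_ ?_ <;>
        · rintro rfl; simp at hp; omega
      refine ⟨_, (eop_eq_some_iff _ _ _ _).2 (Or.inr ⟨?_, k, knej, by rw [w2, kh], rfl⟩),
        (eop_eq_some_iff _ _ _ _).2
          (Or.inl ⟨?_, h, hne, by rw [w3, hh], KPmove_comm hposi hposj
          (by simp) (by simp)⟩)⟩
      · rwa [bStar, aSt, w1, w2]
      · rwa [bStar, aSt, w3, w4]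
  · have hposi := (headMinus_Wstar hh).2
    have hroot := hα _ hposi.ne'
    simp only [IsPos] at hroot
    have w2 : Wstar n j (KPmove α (i, b) (i+1, b)) = Wstar n j α := by
      refine Wstar_congr n fun p hp => KPmove_of_ne α ?_ ?_ <;>
      · rintro rfl; simp at hp; omega
    have hast := (Wword_row_move (j := j) hi hj hh).1
    rcases (eop_eq_some_iff n j α γ).1 hγ with ⟨hcj, k, knej, kh, rfl⟩ | ⟨hcj, k, knej, kh, rfl⟩
    · have hrootj := hα _ (headMinus_Wword kh).2.ne'
      simp only [IsPos] at hrootj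
      have w3 : Wword n i (KPmove α (k, j+1) (k, j)) = Wword n i α := by
        refine Wword_congr n fun p hp => KPmove_of_ne α ?_ ?_ <;>
        · rintro rfl; simp at hp; omega
      obtain ⟨b', h', hb', hh', e1, e2, e3⟩ := row_col_diamond hi hj kh hh (by omega) (by omega) hij
      refine ⟨_, (eop_eq_some_iff _ _ _ _).2 (Or.inl ⟨?_, h', hh', e2, rfl⟩),
        (eop_eq_some_iff _ _ _ _).2 (Or.inr ⟨?_, b', hb', e1, e3.symm⟩)⟩
      · rwa [hast, bStar, w2]
      · rwa [(Wstar_col_move hi hj kh).1, aSt, w3]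
    · have hposj := (headMinus_Wstar kh).2
      have hrootj := hα _ hposj.ne'
      simp only [IsPos] at hrootj
      have w3 : Wword n i (KPmove α (j, k) (j+1, k)) = Wword n i α := by
        refine Wword_congr n fun p hp => KPmove_of_ne α ?_ ?_ <;>
        · rintro rfl; simp at hp; omega
      have w4 : Wstar n i (KPmove α (j, k) (j+1, k)) = Wstar n i α := by
        refine Wstar_congr n fun p hp => KPmove_of_ne α ?_ ?_ <;>
        · rintro rfl; simp at hp; omega
      refine ⟨_, (eop_eq_some_iff _ _ _ _).2 (Or.inr ⟨?_, k, knej, by rw [w2, kh], rfl⟩),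
        (eop_eq_some_iff _ _ _ _).2
          (Or.inr ⟨?_, b, hne, by rw [w4, hh], KPmove_comm hposi hposj
          (by simp) (by simp)⟩)⟩
      · rwa [hast, bStar, w2]
      · rwa [bStar, aSt, w3, w4]

lemma eop_diamond {n i j : ℕ} {α β γ : KPf} (hα : IsKP n α) (hi : i + 1 ≤ n) (hj : j + 1 ≤ n)
    (hij : i + 1 < j ∨ j + 1 < i) (hβ : eop n i α = some β) (hγ : eop n j α = some γ) :
    ∃ δ, eop n j β = some δ ∧ eop n i γ = some δ := by
  rcases hij with hij | hij
  · exact eop_diamond_of_lt hα hj hij hβ hγ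
  · obtain ⟨δ, h1, h2⟩ := eop_diamond_of_lt hα hi hij hγ hβ
    exact ⟨δ, h2, h1⟩

/-! ### Iterating the diamond property -/

lemma iterO_strip {P : KPf → Prop} {f g : KPf → Option KPf}
    (hf : ∀ {x y}, P x → f x = some y → P y)
    (hd : ∀ {x y z}, P x → f x = some y → g x = some z → ∃ u, g y = some u ∧ f z = some u) :
    ∀ (k : ℕ) {x y z : KPf}, P x → iterO f k x = some y → g x = some z →
      ∃ u, g y = some u ∧ iterO f k z = some u := by
  intro k
  induction k with
  | zero =>
    intro x y z _ hy hz
    obtain rfl : x = y := Option.some.inj hy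
    exact ⟨z, hz, rfl⟩
  | succ k ih =>
    intro x y z hx hy hz
    obtain ⟨x', hx', hy'⟩ := Option.bind_eq_some_iff.1 hy
    obtain ⟨z', h1, h2⟩ := hd hx hx' hz
    obtain ⟨u, h3, h4⟩ := ih (hf hx hx') hy' h1
    exact ⟨u, h3, Option.bind_eq_some_iff.2 ⟨z', h2, h4⟩⟩

lemma iterO_diamond {P : KPf → Prop} {f g : KPf → Option KPf}
    (hf : ∀ {x y}, P x → f x = some y → P y) (hg : ∀ {x y}, P x → g x = some y → P y)
    (hd : ∀ {x y z}, P x → f x = some y → g x = some z → ∃ u, g y = some u ∧ f z = some u)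
    (k : ℕ) : ∀ (l : ℕ) {x y z : KPf}, P x → iterO f k x = some y → iterO g l x = some z →
      ∃ u, iterO g l y = some u ∧ iterO f k z = some u := by
  intro l
  induction l with
  | zero =>
    intro x y z _ hy hz
    obtain rfl : x = z := Option.some.inj hz
    exact ⟨y, rfl, hy⟩
  | succ l ih =>
    intro x y z hx hy hz
    obtain ⟨x', hx', hz'⟩ := Option.bind_eq_some_iff.1 hz
    obtain ⟨y', h1, h2⟩ := iterO_strip hf hd k hx hy hx'
    obtain ⟨u, h3, h4⟩ := ih (hg hx hx') h2 hz'
    exact ⟨u, Option.bind_eq_some_iff.2 ⟨y', h1, h3⟩, h4⟩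

end KFC

open KFC in
/-- Braid relation (commuting case) for the `Φ` operators built from `e`:
if `|i−j| > 1`, `k_i, k_j > 0` and both `e_i^{k_i}(α)`, `e_j^{k_j}(α)` are
nonzero, then `e_i^{k_i}(e_j^{k_j}(α)) = e_j^{k_j}(e_i^{k_i}(α)) ≠ 0`. -/
theorem stmt7 (n : ℕ) (hn : 2 ≤ n) (lam mu : ℕ → ℤ)
    (hlam : ∀ k, 1 ≤ k → k < n → lam (k+1) ≤ lam k) (hlamn : lam n = 0)
    (hmu : ∀ k, 1 ≤ k → k < n → mu (k+1) ≤ mu k) (hmun : 0 ≤ mu n)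
    (hcomb : ∃ c : ℕ → ℕ, c 0 = 0 ∧ c n = 0 ∧
      ∀ k, 1 ≤ k → k ≤ n → lam k - mu k = (c k : ℤ) - (c (k-1) : ℤ))
    (w : Equiv.Perm (Fin n)) (α : KPf) (hwα : InS n lam mu w α) (i j : ℕ)
    (hi1 : 1 ≤ i) (hi2 : i ≤ n - 1) (hj1 : 1 ≤ j) (hj2 : j ≤ n - 1)
    (hij : i + 1 < j ∨ j + 1 < i)
    (ki kj : ℤ)
    (hki : ki = pairCo (permAct n w (lamRho n lam)) i)
    (hkj : kj = pairCo (permAct n w (lamRho n lam)) j)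
    (hki0 : 0 < ki) (hkj0 : 0 < kj)
    (hei : iterO (eop n i) ki.toNat α ≠ none)
    (hej : iterO (eop n j) kj.toNat α ≠ none) :
    (iterO (eop n j) kj.toNat α).bind (iterO (eop n i) ki.toNat) =
      (iterO (eop n i) ki.toNat α).bind (iterO (eop n j) kj.toNat) ∧
    (iterO (eop n j) kj.toNat α).bind (iterO (eop n i) ki.toNat) ≠ none := by
  obtain ⟨β, hβ⟩ := Option.ne_none_iff_exists'.1 hei
  obtain ⟨γ, hγ⟩ := Option.ne_none_iff_exists'.1 hej
  obtain ⟨δ, h1, h2⟩ := iterO_diamond (P := IsKP n) (fun hx h => hx.eop hi1 h)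
    (fun hx h => hx.eop hj1 h)
    (fun hx h h' => eop_diamond hx (by omega) (by omega) hij h h') _ _ hwα.1 hβ hγ
  simp [hβ, hγ, h1, h2]
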